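/- The cardinalities of the endomorphism semigroups of the extra-special p-groups of order p^{2n+1} are: |End(ES_1(p,n))| = p^{n²+2n}(p−1)·∏_{j=1}^{n}(p^{2j}−1) + p^{2n}·Σ_{k=0}^{n} α_k(p,n)·γ_k(p,n), and |End(ES_2(p,n))| = p^{n²+2n}(p−1)·∏_{j=1}^{n−1}(p^{2j}−1) + p^{2n}·Σ_{k=0}^{n} β_k(p,n)·γ_k(p,n). -/

import Mathlib

open Matrix

/-- The Heisenberg group `ES₁(p,n)`: carrier `𝔽_p^n × 𝔽_p^n × 𝔽_p`. -/
@[ext]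
structure ES1 (p n : ℕ) : Type where
  u : Fin n → ZMod p
  w : Fin n → ZMod p
  z : ZMod p

namespace ES1

variable {p n : ℕ}

instance : Mul (ES1 p n) :=
  ⟨fun x y => ⟨x.u + y.u, x.w + y.w, x.z + y.z + x.u ⬝ᵥ y.w⟩⟩

@[simp] theorem mul_u (x y : ES1 p n) : (x * y).u = x.u + y.u := rfl
@[simp] theorem mul_w (x y : ES1 p n) : (x * y).w = x.w + y.w := rfl
@[simp] theorem mul_z (x y : ES1 p n) : (x * y).z = x.z + y.z + x.u ⬝ᵥ y.w := rfl

instance : One (ES1 p n) := ⟨⟨0, 0, 0⟩⟩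

@[simp] theorem one_u : (1 : ES1 p n).u = 0 := rfl
@[simp] theorem one_w : (1 : ES1 p n).w = 0 := rfl
@[simp] theorem one_z : (1 : ES1 p n).z = 0 := rfl

instance : Inv (ES1 p n) :=
  ⟨fun x => ⟨-x.u, -x.w, -x.z + x.u ⬝ᵥ x.w⟩⟩

@[simp] theorem inv_u (x : ES1 p n) : (x⁻¹).u = -x.u := rfl
@[simp] theorem inv_w (x : ES1 p n) : (x⁻¹).w = -x.w := rfl
@[simp] theorem inv_z (x : ES1 p n) : (x⁻¹).z = -x.z + x.u ⬝ᵥ x.w := rfl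

instance : Group (ES1 p n) :=
  Group.ofLeftAxioms
    (fun a b c => by
      ext <;> simp [add_dotProduct, dotProduct_add] <;> ring)
    (fun a => by ext <;> simp)
    (fun a => by ext <;> simp [neg_dotProduct] <;> ring)

end ES1

/-- The additive embedding `ℤ/pℤ → ℤ/p²ℤ`, `a ↦ p·a`. -/
def emb (p : ℕ) (a : ZMod p) : ZMod (p ^ 2) := (p : ZMod (p ^ 2)) * (a.val : ZMod (p ^ 2))

/-- Reduction modulo `p`, `ℤ/p²ℤ → ℤ/pℤ`. -/
def red (p : ℕ) : ZMod (p ^ 2) →+* ZMod p :=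
  ZMod.castHom (dvd_pow_self p (by norm_num)) (ZMod p)

section EmbLemmas

variable {p : ℕ} [NeZero p]

theorem emb_sq_zero : (p : ZMod (p ^ 2)) * (p : ZMod (p ^ 2)) = 0 := by
  have h : ((p ^ 2 : ℕ) : ZMod (p ^ 2)) = 0 := ZMod.natCast_self _
  push_cast at h
  linear_combination h

theorem emb_mod (k : ℕ) :
    (p : ZMod (p ^ 2)) * ((k % p : ℕ) : ZMod (p ^ 2)) = (p : ZMod (p ^ 2)) * (k : ℕ) := by
  conv_rhs => rw [← Nat.div_add_mod k p]
  push_cast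
  linear_combination (-((k / p : ℕ) : ZMod (p ^ 2))) * emb_sq_zero (p := p)

theorem emb_add (a b : ZMod p) : emb p (a + b) = emb p a + emb p b := by
  unfold emb
  rw [ZMod.val_add, emb_mod]
  push_cast
  ring

theorem emb_zero : emb p (0 : ZMod p) = 0 := by
  simp [emb]

theorem emb_neg (a : ZMod p) : emb p (-a) = -emb p a := by
  have h := emb_add (p := p) (-a) a
  rw [neg_add_cancel, emb_zero] at h
  exact eq_neg_of_add_eq_zero_left h.symm

theorem emb_sub (a b : ZMod p) : emb p (a - b) = emb p a - emb p b := by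
  rw [sub_eq_add_neg, emb_add, emb_neg]; ring

theorem emb_mul_emb (a b : ZMod p) : emb p a * emb p b = 0 := by
  unfold emb
  calc (p : ZMod (p ^ 2)) * (a.val : ZMod (p ^ 2)) * ((p : ZMod (p ^ 2)) * (b.val : ZMod (p ^ 2)))
      = ((p : ZMod (p^2)) * (p : ZMod (p^2))) * ((a.val : ZMod (p ^ 2)) * (b.val : ZMod (p ^ 2))) := by ring
    _ = 0 := by rw [emb_sq_zero]; ring

theorem red_emb (a : ZMod p) : red p (emb p a) = 0 := by
  unfold emb
  rw [_root_.map_mul, map_natCast, ZMod.natCast_self]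
  ring

end EmbLemmas

/-- The extra-special `p`-group of exponent `p²` and order `p^(2(m+1)+1)`
(so `n = m + 1` in the paper's notation). -/
@[ext]
structure ES2 (p m : ℕ) : Type where
  u1 : ZMod (p ^ 2)
  u : Fin m → ZMod p
  w1 : ZMod p
  w : Fin m → ZMod p

namespace ES2

variable {p m : ℕ}

instance : Mul (ES2 p m) :=
  ⟨fun x y => ⟨x.u1 + y.u1 + emb p y.w1 * x.u1 + emb p (x.u ⬝ᵥ y.w),
    x.u + y.u, x.w1 + y.w1, x.w + y.w⟩⟩

@[simp] theorem mul_u1 (x y : ES2 p m) :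
    (x * y).u1 = x.u1 + y.u1 + emb p y.w1 * x.u1 + emb p (x.u ⬝ᵥ y.w) := rfl
@[simp] theorem mul_u (x y : ES2 p m) : (x * y).u = x.u + y.u := rfl
@[simp] theorem mul_w1 (x y : ES2 p m) : (x * y).w1 = x.w1 + y.w1 := rfl
@[simp] theorem mul_w (x y : ES2 p m) : (x * y).w = x.w + y.w := rfl

instance : One (ES2 p m) := ⟨⟨0, 0, 0, 0⟩⟩

@[simp] theorem one_u1 : (1 : ES2 p m).u1 = 0 := rfl
@[simp] theorem one_u : (1 : ES2 p m).u = 0 := rfl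
@[simp] theorem one_w1 : (1 : ES2 p m).w1 = 0 := rfl
@[simp] theorem one_w : (1 : ES2 p m).w = 0 := rfl

instance : Inv (ES2 p m) :=
  ⟨fun x => ⟨(1 - emb p x.w1) * (-x.u1 + emb p (x.u ⬝ᵥ x.w)), -x.u, -x.w1, -x.w⟩⟩

@[simp] theorem inv_u1 (x : ES2 p m) :
    (x⁻¹).u1 = (1 - emb p x.w1) * (-x.u1 + emb p (x.u ⬝ᵥ x.w)) := rfl
@[simp] theorem inv_u (x : ES2 p m) : (x⁻¹).u = -x.u := rfl
@[simp] theorem inv_w1 (x : ES2 p m) : (x⁻¹).w1 = -x.w1 := rfl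
@[simp] theorem inv_w (x : ES2 p m) : (x⁻¹).w = -x.w := rfl

instance [NeZero p] : Group (ES2 p m) :=
  Group.ofLeftAxioms
    (fun a b c => by
      ext
      · simp only [mul_u1, mul_u, mul_w1, mul_w, add_dotProduct, dotProduct_add, emb_add]
        linear_combination a.u1 * emb_mul_emb c.w1 b.w1 +
          emb_mul_emb c.w1 (a.u ⬝ᵥ b.w)
      · simp [add_assoc]
      · simp [add_assoc]
      · simp [add_assoc])
    (fun a => by
      ext <;> simp [emb_zero])
    (fun a => by
      ext
      · simp only [mul_u1, inv_u1, inv_u, inv_w1, inv_w, one_u1, neg_dotProduct, emb_neg]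
        linear_combination (a.u1 - emb p (a.u ⬝ᵥ a.w)) * emb_mul_emb a.w1 a.w1
      · simp
      · simp
      · simp)

end ES2

/-- The standard symplectic matrix `Δ = [[0, Iₙ], [-Iₙ, 0]]`. -/
def Delta (p n : ℕ) : Matrix (Fin n ⊕ Fin n) (Fin n ⊕ Fin n) (ZMod p) :=
  Matrix.fromBlocks 0 1 (-1) 0

theorem abstract_count {p : ℕ} [Fact p.Prime] {V : Type} [AddCommGroup V] [Module (ZMod p) V]
    [Finite V]
    {G : Type} [Group G] (ω : V →ₗ[ZMod p] V →ₗ[ZMod p] ZMod p) (f : V)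
    (π : G → V) (ι : ZMod p → G)
    (hπ : ∀ x y, π (x * y) = π x + π y) (hπs : Function.Surjective π)
    (hι : ∀ a b, ι (a + b) = ι a * ι b) (hιi : Function.Injective ι)
    (hιc : ∀ a x, ι a * x = x * ι a)
    (hker : ∀ x, π x = 0 ↔ ∃ a, x = ι a)
    (hcomm : ∀ x y, x * y = y * x * ι (ω (π x) (π y)))
    (hpow : ∀ x, x ^ p = ι (ω (π x) f))
    (hone : ∃ v w, ω v w = 1)
    (hex : ∀ (L : V →ₗ[ZMod p] V) (c : ZMod p), (∀ v w, ω (L v) (L w) = c * ω v w) →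
      (∀ v, ω (L v) f = c * ω v f) →
      ∃ φ : G →* G, (∀ x, π (φ x) = L (π x)) ∧ ∀ a, φ (ι a) = ι (c * a)) :
    Nat.card (G →* G) = Nat.card {q : (V →ₗ[ZMod p] V) × ZMod p //
      (∀ v w, ω (q.1 v) (q.1 w) = q.2 * ω v w) ∧ ∀ v, ω (q.1 v) f = q.2 * ω v f} *
      Nat.card (V →ₗ[ZMod p] ZMod p) := by
  have hι0 : ι 0 = 1 := by
    have := hι 0 0
    simpa using this
  have hπ1 : π 1 = 0 := by
    have := hπ 1 1
    simpa using this
  have hπι : ∀ a, π (ι a) = 0 := fun a => (hker _).2 ⟨a, rfl⟩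
  have hπinv : ∀ x, π x⁻¹ = - π x := fun x => by
    have := hπ x x⁻¹
    rw [mul_inv_cancel, hπ1] at this
    exact (neg_eq_of_add_eq_zero_right this.symm).symm
  choose Φ hΦ using fun q : {q : (V →ₗ[ZMod p] V) × ZMod p //
      (∀ v w, ω (q.1 v) (q.1 w) = q.2 * ω v w) ∧ ∀ v, ω (q.1 v) f = q.2 * ω v f} =>
      hex q.1.1 q.1.2 q.2.1 q.2.2
  rw [← Nat.card_prod]
  symm
  let T : ({q : (V →ₗ[ZMod p] V) × ZMod p //
      (∀ v w, ω (q.1 v) (q.1 w) = q.2 * ω v w) ∧ ∀ v, ω (q.1 v) f = q.2 * ω v f} ×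
      (V →ₗ[ZMod p] ZMod p)) → (G →* G) := fun q =>
    { toFun := fun x => Φ q.1 x * ι (q.2 (π x))
      map_one' := by simp [hπ1, hι0]
      map_mul' := fun x y => by
        rw [map_mul, hπ, map_add, hι]
        simp only [mul_assoc]
        congr 1
        rw [← mul_assoc, ← mul_assoc, hιc (q.2 (π x)) (Φ q.1 y)] }
  have hT : ∀ q x, T q x = Φ q.1 x * ι (q.2 (π x)) := fun q x => rfl
  have hT1 : ∀ q x, π (T q x) = q.1.1.1 (π x) := fun q x => by
    rw [hT, hπ, hπι, add_zero, (hΦ q.1).1]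
  have hT2 : ∀ q a, T q (ι a) = ι (q.1.1.2 * a) := fun q a => by
    rw [hT, hπι, map_zero, hι0, mul_one, (hΦ q.1).2]
  refine Nat.card_eq_of_bijective T ⟨?_, ?_⟩
  · intro q q' h
    have h1 : q.1 = q'.1 := by
      apply Subtype.ext
      apply Prod.ext
      · ext v
        obtain ⟨x, rfl⟩ := hπs v
        rw [← hT1, ← hT1, h]
      · have := hT2 q 1
        rw [h, hT2, mul_one, mul_one] at this
        exact (hιi this).symm
    apply Prod.ext h1
    ext v
    obtain ⟨x, rfl⟩ := hπs v
    have := hT q x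
    rw [h, hT, h1] at this
    exact (hιi (mul_left_cancel this)).symm
  · intro φ
    obtain ⟨v, w, hvw⟩ := hone
    obtain ⟨x, rfl⟩ := hπs v
    obtain ⟨y, rfl⟩ := hπs w
    have hc1 : φ (ι 1) = ι (ω (π (φ x)) (π (φ y))) := by
      have h1 := congrArg φ (hcomm x y)
      rw [hvw, map_mul, map_mul, map_mul, hcomm (φ x)] at h1
      exact (mul_left_cancel h1).symm
    obtain ⟨c, hc⟩ : ∃ c, φ (ι 1) = ι c := ⟨_, hc1⟩
    have hιn : ∀ (k : ℕ) (a : ZMod p), ι a ^ k = ι (k * a) := fun k a => by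
      induction k with
      | zero => simp [hι0]
      | succ k ih => rw [pow_succ, ih, ← hι]; congr 1; push_cast; ring
    have hca : ∀ a, φ (ι a) = ι (c * a) := fun a => by
      have : ι a = ι 1 ^ a.val := by rw [hιn]; simp
      rw [this, map_pow, hc, hιn]
      simp [mul_comm]
    choose s hs using hπs
    have hs' : ∀ x, ∃ a, x = s (π x) * ι a := fun x => by
      obtain ⟨a, ha⟩ := (hker ((s (π x))⁻¹ * x)).1 (by rw [hπ, hπinv, hs]; simp)
      exact ⟨a, by rw [← ha]; simp⟩
    have hfac : ∀ {A : Type} [AddCommGroup A] (g : G → A), (∀ x y, g (x * y) = g x + g y) →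
        (∀ a, g (ι a) = 0) → ∀ x, g x = g (s (π x)) := fun g h1 h2 x => by
      obtain ⟨a, ha⟩ := hs' x
      conv_lhs => rw [ha]
      rw [h1, h2, add_zero]
    have hlin : ∀ {A : Type} [AddCommGroup A] [Module (ZMod p) A] (g : G → A),
        (∀ x y, g (x * y) = g x + g y) →
        (∀ a, g (ι a) = 0) → ∃ l : V →ₗ[ZMod p] A, ∀ x, l (π x) = g x := fun g h1 h2 => by
      have key := hfac g h1 h2
      let l0 : V →+ _ := AddMonoidHom.mk' (fun v => g (s v)) (fun v w => by
        rw [← h1, key (s v * s w), hπ, hs, hs])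
      exact ⟨l0.toZModLinearMap p, fun x => (key x).symm⟩
    obtain ⟨L, hL⟩ := hlin (fun x => π (φ x)) (fun x y => by rw [map_mul, hπ])
      (fun a => by rw [hca, hπι])
    have hq1 : ∀ v w, ω (L v) (L w) = c * ω v w := fun v w => by
      rw [← hs v, ← hs w, hL, hL]
      have h1 := congrArg φ (hcomm (s v) (s w))
      rw [map_mul, map_mul, map_mul, hcomm (φ _), hca] at h1
      exact hιi (mul_left_cancel h1)
    have hq2 : ∀ v, ω (L v) f = c * ω v f := fun v => by
      rw [← hs v, hL]
      have h1 := congrArg φ (hpow (s v))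
      rw [map_pow, hpow, hca] at h1
      exact hιi h1
    let q : {q : (V →ₗ[ZMod p] V) × ZMod p //
      (∀ v w, ω (q.1 v) (q.1 w) = q.2 * ω v w) ∧ ∀ v, ω (q.1 v) f = q.2 * ω v f} :=
      ⟨(L, c), hq1, hq2⟩
    have hr : ∀ x, ∃ a, φ x = Φ q x * ι a := fun x => by
      obtain ⟨a, ha⟩ := (hker ((Φ q x)⁻¹ * φ x)).1 (by
        rw [hπ, hπinv, (hΦ q).1]; simp [q, hL])
      exact ⟨a, by rw [← ha]; simp⟩
    choose r hr using hr
    obtain ⟨l, hl⟩ := hlin r (fun x y => by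
        apply hιi
        apply mul_left_cancel (a := Φ q (x * y))
        rw [← hr, map_mul, hr, hr, map_mul, hι]
        simp only [mul_assoc]
        congr 1
        rw [← mul_assoc, ← mul_assoc, hιc (r x)])
      (fun a => by
        apply hιi
        apply mul_left_cancel (a := Φ q (ι a))
        rw [← hr, hca, (hΦ q).2, hι0, mul_one])
    refine ⟨(q, l), ?_⟩
    ext x
    rw [hT, hl, ← hr]

/-- Conformal symplectic frames with multiplier `c`. -/
def IsFrame {p : ℕ} {V : Type} [AddCommGroup V] [Module (ZMod p) V]
    (ω : V →ₗ[ZMod p] V →ₗ[ZMod p] ZMod p) (c : ZMod p) {n : ℕ} (F : Fin n → V × V) : Prop :=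
  ∀ i j, ω (F i).1 (F j).1 = 0 ∧ ω (F i).2 (F j).2 = 0 ∧
    ω (F i).1 (F j).2 = if i = j then c else 0

/-- Orthogonal complement of a pair of vectors. -/
def perp2 {p : ℕ} {V : Type} [AddCommGroup V] [Module (ZMod p) V]
    (ω : V →ₗ[ZMod p] V →ₗ[ZMod p] ZMod p) (a b : V) : Submodule (ZMod p) V :=
  LinearMap.ker (ω a) ⊓ LinearMap.ker (ω b)

theorem mem_perp2 {p : ℕ} {V : Type} [AddCommGroup V] [Module (ZMod p) V]
    {ω : V →ₗ[ZMod p] V →ₗ[ZMod p] ZMod p} {a b v : V} :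
    v ∈ perp2 ω a b ↔ ω a v = 0 ∧ ω b v = 0 := by
  simp [perp2]

theorem card_fibre {p : ℕ} [Fact p.Prime] {V : Type} [AddCommGroup V] [Module (ZMod p) V]
    [Finite V] (l : V →ₗ[ZMod p] ZMod p) (hl : l ≠ 0) (c : ZMod p) (n : ℕ)
    (hV : Nat.card V = p ^ (n + 1)) : Nat.card {a // l a = c} = p ^ n := by
  obtain ⟨v0, hv0⟩ : ∃ v, l v ≠ 0 := by
    by_contra! h
    exact hl (LinearMap.ext h)
  obtain ⟨v1, hv1⟩ : ∃ v, l v = 1 := ⟨(l v0)⁻¹ • v0, by simp [hv0]⟩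
  have e : V ≃ {a // l a = c} × ZMod p :=
    { toFun := fun v => (⟨v - (l v - c) • v1, by simp [hv1]⟩, l v)
      invFun := fun q => q.1.1 + (q.2 - c) • v1
      left_inv := fun v => by simp
      right_inv := fun q => by
        obtain ⟨⟨a, ha⟩, b⟩ := q
        simp [ha, hv1] }
  have h := Nat.card_congr e
  rw [Nat.card_prod, Nat.card_zmod, hV, pow_succ] at h
  exact (Nat.eq_of_mul_eq_mul_right (Fact.out : p.Prime).pos h).symm

theorem card_frames_fixed {p : ℕ} [Fact p.Prime] {V : Type} [AddCommGroup V]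
    [Module (ZMod p) V] [Finite V]
    (ω : V →ₗ[ZMod p] V →ₗ[ZMod p] ZMod p) (halt : ∀ v, ω v v = 0)
    (hnd : ∀ v, (∀ w, ω v w = 0) → v = 0)
    (c : ZMod p) (hc : c ≠ 0) (n N : ℕ) (hV : Nat.card V = p ^ (2 * (n + 1)))
    (IH : ∀ {W : Type} [AddCommGroup W] [Module (ZMod p) W] [Finite W]
      (ω : W →ₗ[ZMod p] W →ₗ[ZMod p] ZMod p), (∀ v, ω v v = 0) →
      (∀ v, (∀ w, ω v w = 0) → v = 0) → Nat.card W = p ^ (2 * n) →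
      Nat.card {F : Fin n → W × W // IsFrame ω c F} = N)
    (f : V) (hf : f ≠ 0) :
    Nat.card {F : Fin (n + 1) → V × V // IsFrame ω c F ∧ (F 0).2 = f} = p ^ (2 * n + 1) * N := by
  have hskew : ∀ v w, ω v w = - ω w v := fun v w => by
    have := halt (v + w)
    simp only [map_add, LinearMap.add_apply, halt] at this
    linear_combination this
  have e : {F : Fin (n + 1) → V × V // IsFrame ω c F ∧ (F 0).2 = f} ≃
      Σ a : {a // ω f a = -c}, {F : Fin n → (perp2 ω a.1 f) × (perp2 ω a.1 f) //
        IsFrame ((ω.domRestrict₁₂ (perp2 ω a.1 f) (perp2 ω a.1 f))) c F} :=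
    { toFun := fun F => ⟨⟨(F.1 0).1, by
          have h := (F.2.1 0 0).2.2
          rw [F.2.2, if_pos rfl] at h
          rw [hskew, h]⟩,
        ⟨fun i => (⟨(F.1 i.succ).1, mem_perp2.2 ⟨(F.2.1 _ _).1, by
            have h := (F.2.1 i.succ 0).2.2
            rw [F.2.2, if_neg (Fin.succ_ne_zero i)] at h
            rw [hskew, h, neg_zero]⟩⟩,
          ⟨(F.1 i.succ).2, mem_perp2.2 ⟨by
            rw [(F.2.1 _ _).2.2, if_neg (Fin.succ_ne_zero i).symm], by
            have h := (F.2.1 0 i.succ).2.1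
            rwa [F.2.2] at h⟩⟩),
         fun i j => ⟨(F.2.1 _ _).1, (F.2.1 _ _).2.1, by
           have := (F.2.1 i.succ j.succ).2.2
           simpa [LinearMap.domRestrict₁₂_apply] using this⟩⟩⟩
      invFun := fun q => ⟨Fin.cons (q.1.1, f) (fun i => ((q.2.1 i).1.1, (q.2.1 i).2.1)), by
        obtain ⟨⟨a, ha⟩, F, hF⟩ := q
        have hfa : ω a f = c := by rw [hskew, ha, neg_neg]
        refine ⟨fun i j => ?_, rfl⟩
        induction i using Fin.cases with
        | zero =>
          induction j using Fin.cases with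
          | zero => simp [halt, hfa]
          | succ j =>
            have h1 := mem_perp2.1 (F j).1.2
            have h2 := mem_perp2.1 (F j).2.2
            simp only [Fin.cons_zero, Fin.cons_succ]
            refine ⟨h1.1, h2.2, ?_⟩
            rw [if_neg (Fin.succ_ne_zero j).symm]
            exact h2.1
        | succ i =>
          have h1 := mem_perp2.1 (F i).1.2
          have h2 := mem_perp2.1 (F i).2.2
          induction j using Fin.cases with
          | zero =>
            simp only [Fin.cons_zero, Fin.cons_succ]
            refine ⟨by rw [hskew, h1.1, neg_zero], by rw [hskew, h2.2, neg_zero], ?_⟩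
            rw [if_neg (Fin.succ_ne_zero i), hskew, h1.2, neg_zero]
          | succ j =>
            have := hF i j
            simpa [LinearMap.domRestrict₁₂_apply] using this⟩
      left_inv := fun F => by
        obtain ⟨F, hF, rfl⟩ := F
        apply Subtype.ext
        funext i
        induction i using Fin.cases with
        | zero => rfl
        | succ i => rfl
      right_inv := fun q => rfl }
  rw [Nat.card_congr e]
  have := Fintype.ofFinite {a // ω f a = -c}
  rw [Nat.card_sigma, Finset.sum_congr rfl (g := fun _ => N), Finset.sum_const, Finset.card_univ,
    ← Nat.card_eq_fintype_card, card_fibre (ω f) _ (-c) (2 * n + 1) hV, smul_eq_mul]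
  · intro h
    exact hf (hnd f fun w => by rw [h]; rfl)
  · rintro ⟨a, ha⟩ -
    have hfa : ω a f = c := by rw [hskew, ha, neg_neg]
    have hproj : ∀ v : V, v - (c⁻¹ * ω v f) • a - (c⁻¹ * ω a v) • f ∈ perp2 ω a f := fun v => by
      rw [mem_perp2]
      simp only [map_sub, map_smul, halt, ha, hfa, smul_eq_mul, mul_zero, sub_zero]
      constructor
      · field_simp; ring
      · rw [hskew v f]; field_simp; ring
    apply IH
    · intro v; exact halt _
    · intro v hv
      apply Subtype.ext
      apply hnd
      intro w
      have h1 := hv ⟨_, hproj w⟩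
      have h2 := mem_perp2.1 v.2
      have h3 : ω v.1 (w - (c⁻¹ * ω w f) • a - (c⁻¹ * ω a w) • f) = 0 := h1
      simp only [map_sub, map_smul, hskew v.1 a, hskew v.1 f, h2.1, h2.2] at h3
      simpa using h3
    · have e2 : V ≃ (perp2 ω a f) × ZMod p × ZMod p :=
        { toFun := fun v => (⟨_, hproj v⟩, c⁻¹ * ω v f, c⁻¹ * ω a v)
          invFun := fun q => q.1.1 + q.2.1 • a + q.2.2 • f
          left_inv := fun v => by simp only; abel
          right_inv := fun q => by
            obtain ⟨⟨v, hv⟩, s, t⟩ := q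
            have h2 := mem_perp2.1 hv
            have hs : c⁻¹ * ω (v + s • a + t • f) f = s := by
              simp only [map_add, map_smul, LinearMap.add_apply, LinearMap.smul_apply, halt, hfa,
                hskew v f, h2.2, smul_eq_mul]
              field_simp
              ring
            have ht : c⁻¹ * ω a (v + s • a + t • f) = t := by
              simp only [map_add, map_smul, halt, hfa, h2.1, smul_eq_mul]
              field_simp
              ring
            refine Prod.ext (Subtype.ext ?_) (Prod.ext hs ht)
            simp only [hs, ht]
            abel }
      have h := Nat.card_congr e2
      rw [Nat.card_prod, Nat.card_prod, Nat.card_zmod, hV] at h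
      have hp := (Fact.out : p.Prime).pos
      apply Nat.eq_of_mul_eq_mul_right (Nat.mul_pos hp hp)
      rw [← h]; ring

theorem card_frames {p : ℕ} [Fact p.Prime] (c : ZMod p) (hc : c ≠ 0) (n : ℕ) :
    ∀ {V : Type} [AddCommGroup V] [Module (ZMod p) V] [Finite V]
    (ω : V →ₗ[ZMod p] V →ₗ[ZMod p] ZMod p), (∀ v, ω v v = 0) →
    (∀ v, (∀ w, ω v w = 0) → v = 0) → Nat.card V = p ^ (2 * n) →
    Nat.card {F : Fin n → V × V // IsFrame ω c F} =
      p ^ (n ^ 2) * ∏ j ∈ Finset.Icc 1 n, (p ^ (2 * j) - 1) := by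
  induction n with
  | zero =>
    intro V _ _ _ ω _ _ _
    have : Unique {F : Fin 0 → V × V // IsFrame ω c F} :=
      { default := ⟨Fin.elim0, fun i => i.elim0⟩
        uniq := fun F => Subtype.ext (funext fun i => i.elim0) }
    simp
  | succ n ih =>
    intro V _ _ _ ω halt hnd hV
    have e : {F : Fin (n + 1) → V × V // IsFrame ω c F} ≃
        Σ f : {f : V // f ≠ 0}, {F : Fin (n + 1) → V × V // IsFrame ω c F ∧ (F 0).2 = f} :=
      { toFun := fun F => ⟨⟨(F.1 0).2, fun h => by
          have := (F.2 0 0).2.2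
          rw [h] at this
          simp at this
          exact hc this.symm⟩, ⟨F.1, F.2, rfl⟩⟩
        invFun := fun q => ⟨q.2.1, q.2.2.1⟩
        left_inv := fun F => rfl
        right_inv := fun q => by
          obtain ⟨⟨f, hf⟩, F, hF, h⟩ := q
          simp only at h
          subst h
          rfl }
    classical
    have := Fintype.ofFinite V
    rw [Nat.card_congr e, Nat.card_sigma, Finset.sum_congr rfl (fun f _ =>
      card_frames_fixed ω halt hnd c hc n _ hV (fun ω h1 h2 h3 => ih ω h1 h2 h3) f.1 f.2),
      Finset.sum_const, Finset.card_univ, Fintype.card_subtype_compl, ← Nat.card_eq_fintype_card,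
      hV, Finset.prod_Icc_succ_top (by omega)]
    simp only [Fintype.card_unique, smul_eq_mul]
    ring

theorem isotropic_finrank_le {p : ℕ} [Fact p.Prime] {V : Type} [AddCommGroup V]
    [Module (ZMod p) V] [Module.Finite (ZMod p) V]
    (ω : V →ₗ[ZMod p] V →ₗ[ZMod p] ZMod p)
    (hnd : ∀ v, (∀ w, ω v w = 0) → v = 0) (n : ℕ) (hV : Module.finrank (ZMod p) V = 2 * n)
    (W : Submodule (ZMod p) V) (hW : ∀ v ∈ W, ∀ w ∈ W, ω v w = 0) :
    Module.finrank (ZMod p) W ≤ n := by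
  have h1 : Function.Injective ω := by
    rw [← LinearMap.ker_eq_bot, LinearMap.ker_eq_bot']
    intro v hv
    exact hnd v fun w => by rw [hv]; rfl
  have h2 : Function.Surjective ω := by
    rwa [← LinearMap.injective_iff_surjective_of_finrank_eq_finrank
      (Subspace.dual_finrank_eq).symm]
  have h3 : Function.Surjective (W.subtype.dualMap ∘ₗ ω) := by
    rw [LinearMap.coe_comp]
    exact (LinearMap.dualMap_surjective_of_injective W.subtype_injective).comp h2
  have h4 := LinearMap.finrank_range_add_finrank_ker (W.subtype.dualMap ∘ₗ ω)
  have h5 : W ≤ LinearMap.ker (W.subtype.dualMap ∘ₗ ω) := by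
    intro v hv
    rw [LinearMap.mem_ker]
    ext w
    exact hW v hv w w.2
  have h6 := Submodule.finrank_mono h5
  rw [LinearMap.range_eq_top.2 h3, finrank_top, Subspace.dual_finrank_eq, hV] at h4
  omega

theorem card_isotropic_maps {p : ℕ} [Fact p.Prime] {V : Type} [AddCommGroup V]
    [Module (ZMod p) V] [Finite V]
    (P : Submodule (ZMod p) V → Prop) (n : ℕ)
    (hP : ∀ W, P W → Module.finrank (ZMod p) W ≤ n) :
    Nat.card {L : V →ₗ[ZMod p] V // P (LinearMap.range L)} =
      ∑ k ∈ Finset.range (n + 1), Nat.card {W : Submodule (ZMod p) V //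
        P W ∧ Module.finrank (ZMod p) W = k} *
        Nat.card {f : V →ₗ[ZMod p] (Fin k → ZMod p) // Function.Surjective f} := by
  have : Finite (V →ₗ[ZMod p] V) := Finite.of_injective (fun L => (L : V → V)) DFunLike.coe_injective
  have hf : ∀ k, Finite (V →ₗ[ZMod p] (Fin k → ZMod p)) := fun k =>
    Finite.of_injective (fun L => (L : V → _)) DFunLike.coe_injective
  have hfs : Finite (Submodule (ZMod p) V) :=
    Finite.of_injective (fun W => (W : Set V)) SetLike.coe_injective
  have h1 : ∀ k : ℕ, ∀ W : {W : Submodule (ZMod p) V // P W ∧ Module.finrank (ZMod p) W = k},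
      Nonempty (W.1 ≃ₗ[ZMod p] (Fin k → ZMod p)) := fun k W =>
    FiniteDimensional.nonempty_linearEquiv_of_finrank_eq (by rw [W.2.2]; simp)
  let e1 : ∀ k : ℕ, ∀ W : {W : Submodule (ZMod p) V // P W ∧ Module.finrank (ZMod p) W = k},
      (W.1 ≃ₗ[ZMod p] (Fin k → ZMod p)) := fun k W => (h1 k W).some
  let T : (Σ k : Fin (n + 1), {W : Submodule (ZMod p) V //
        P W ∧ Module.finrank (ZMod p) W = k} ×
        {f : V →ₗ[ZMod p] (Fin k → ZMod p) // Function.Surjective f}) →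
      {L : V →ₗ[ZMod p] V // P (LinearMap.range L)} := fun q =>
    ⟨q.2.1.1.subtype ∘ₗ (e1 _ q.2.1).symm.toLinearMap ∘ₗ q.2.2.1, by
      have : LinearMap.range ((e1 _ q.2.1).symm.toLinearMap ∘ₗ q.2.2.1) = ⊤ :=
        LinearMap.range_eq_top.2 ((e1 _ q.2.1).symm.surjective.comp q.2.2.2)
      rw [LinearMap.range_comp, this, Submodule.map_top, Submodule.range_subtype]
      exact q.2.1.2.1⟩
  have hT : ∀ q, LinearMap.range (T q).1 = q.2.1.1 := fun q => by
    have : LinearMap.range ((e1 _ q.2.1).symm.toLinearMap ∘ₗ q.2.2.1) = ⊤ :=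
        LinearMap.range_eq_top.2 ((e1 _ q.2.1).symm.surjective.comp q.2.2.2)
    simp only [T]
    rw [LinearMap.range_comp, this, Submodule.map_top, Submodule.range_subtype]
  have hb : Function.Bijective T := by
    constructor
    · rintro ⟨k, W, f⟩ ⟨k', W', f'⟩ h
      have hW : W.1 = W'.1 := by
        have h1 := hT ⟨k, W, f⟩
        have h2 := hT ⟨k', W', f'⟩
        rw [h] at h1
        exact h1.symm.trans h2
      have hk : k = k' := by
        apply Fin.ext
        rw [← W.2.2, ← W'.2.2, hW]
      subst hk
      have hW' : W = W' := Subtype.ext hW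
      subst hW'
      have : f = f' := by
        apply Subtype.ext
        ext1 v
        have h3 := congrArg (fun L => L.1 v) h
        simp only [T, LinearMap.comp_apply, Submodule.subtype_apply] at h3
        exact (e1 _ W).symm.injective (Subtype.ext h3)
      rw [this]
    · rintro ⟨L, hL⟩
      let W : {W : Submodule (ZMod p) V //
        P W ∧ Module.finrank (ZMod p) W =
          (⟨Module.finrank (ZMod p) (LinearMap.range L), Nat.lt_succ_of_le (hP _ hL)⟩ : Fin (n+1))} :=
        ⟨LinearMap.range L, hL, rfl⟩
      refine ⟨⟨_, W, ⟨(e1 _ W).toLinearMap ∘ₗ L.rangeRestrict,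
        (e1 _ W).surjective.comp L.surjective_rangeRestrict⟩⟩, ?_⟩
      apply Subtype.ext
      ext1 v
      simp [T, W]
  rw [← Nat.card_eq_of_bijective T hb, Nat.card_sigma, Finset.sum_range]
  simp only [Nat.card_prod]

/-- The standard symplectic form as a bilinear map. -/
noncomputable def om (p n : ℕ) : (Fin n ⊕ Fin n → ZMod p) →ₗ[ZMod p]
    (Fin n ⊕ Fin n → ZMod p) →ₗ[ZMod p] ZMod p :=
  Matrix.toLinearMap₂' (ZMod p) (Delta p n)

theorem om_apply (p n : ℕ) (v w : Fin n ⊕ Fin n → ZMod p) :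
    om p n v w = v ⬝ᵥ (Delta p n *ᵥ w) := by
  rw [om, Matrix.toLinearMap₂'_apply']

theorem om_eq (p n : ℕ) (v w : Fin n ⊕ Fin n → ZMod p) :
    om p n v w = (fun i => v (Sum.inl i)) ⬝ᵥ (fun i => w (Sum.inr i)) -
      (fun i => w (Sum.inl i)) ⬝ᵥ (fun i => v (Sum.inr i)) := by
  rw [om_apply, Delta, Matrix.fromBlocks_mulVec]
  simp only [dotProduct, Fintype.sum_sum_type, Sum.elim_inl, Sum.elim_inr]
  rw [sub_eq_add_neg, ← Finset.sum_neg_distrib]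
  congr 1
  · simp [Function.comp_def]
  · refine Finset.sum_congr rfl fun i _ => ?_
    simp [Matrix.neg_mulVec, Function.comp_def, mul_comm]

theorem om_self (p n : ℕ) (v : Fin n ⊕ Fin n → ZMod p) : om p n v v = 0 := by
  rw [om_eq, sub_self]

theorem om_single_inr (p n : ℕ) (v : Fin n ⊕ Fin n → ZMod p) (i : Fin n) :
    om p n v (Pi.single (Sum.inr i) 1) = v (Sum.inl i) := by
  rw [om_apply, Delta]
  simp [om_apply, Delta, Matrix.mulVec_single_one, dotProduct, Fintype.sum_sum_type,
    Matrix.one_apply]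

theorem om_single_inl (p n : ℕ) (v : Fin n ⊕ Fin n → ZMod p) (i : Fin n) :
    om p n v (Pi.single (Sum.inl i) 1) = - v (Sum.inr i) := by
  rw [om_apply, Delta]
  simp [om_apply, Delta, Matrix.mulVec_single_one, dotProduct, Fintype.sum_sum_type,
    Matrix.one_apply]

theorem om_nd (p n : ℕ) (v : Fin n ⊕ Fin n → ZMod p) (h : ∀ w, om p n v w = 0) : v = 0 := by
  funext i
  rcases i with i | i
  · exact (om_single_inr p n v i).symm.trans (h _)
  · have := h (Pi.single (Sum.inl i) 1)
    rw [om_single_inl] at this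
    simpa using this

/-- Linear maps as families of pairs of vectors. -/
noncomputable def linFrame (p n : ℕ) :
    ((Fin n ⊕ Fin n → ZMod p) →ₗ[ZMod p] (Fin n ⊕ Fin n → ZMod p)) ≃
      (Fin n → (Fin n ⊕ Fin n → ZMod p) × (Fin n ⊕ Fin n → ZMod p)) where
  toFun L i := (L (Pi.single (Sum.inl i) 1), L (Pi.single (Sum.inr i) 1))
  invFun F := (Pi.basisFun (ZMod p) (Fin n ⊕ Fin n)).constr ℕ
    (Sum.elim (fun i => (F i).1) (fun i => (F i).2))
  left_inv L := by
    apply (Pi.basisFun (ZMod p) (Fin n ⊕ Fin n)).ext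
    intro i
    rw [Module.Basis.constr_basis]
    rcases i with i | i <;> simp
  right_inv F := by
    funext i
    have h1 := Module.Basis.constr_basis (Pi.basisFun (ZMod p) (Fin n ⊕ Fin n)) ℕ
      (Sum.elim (fun i => (F i).1) (fun i => (F i).2)) (Sum.inl i)
    have h2 := Module.Basis.constr_basis (Pi.basisFun (ZMod p) (Fin n ⊕ Fin n)) ℕ
      (Sum.elim (fun i => (F i).1) (fun i => (F i).2)) (Sum.inr i)
    rw [Pi.basisFun_apply] at h1 h2
    exact Prod.ext h1 h2

theorem linFrame_iff (p n : ℕ) (c : ZMod p)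
    (L : (Fin n ⊕ Fin n → ZMod p) →ₗ[ZMod p] (Fin n ⊕ Fin n → ZMod p)) :
    (∀ v w, om p n (L v) (L w) = c * om p n v w) ↔ IsFrame (om p n) c (linFrame p n L) := by
  constructor
  · intro h i j
    simp only [linFrame, Equiv.coe_fn_mk, h, om_single_inl, om_single_inr]
    refine ⟨by simp, by simp, ?_⟩
    rw [Pi.single_apply]
    simp [eq_comm]
  · intro h
    have hskew : ∀ v w, om p n v w = - om p n w v := fun v w => by
      rw [om_eq, om_eq]; ring
    have : (om p n).compl₁₂ L L = c • om p n := by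
      apply LinearMap.ext_basis (Pi.basisFun (ZMod p) (Fin n ⊕ Fin n))
        (Pi.basisFun (ZMod p) (Fin n ⊕ Fin n))
      intro i j
      simp only [Pi.basisFun_apply, LinearMap.compl₁₂_apply, LinearMap.smul_apply, smul_eq_mul]
      rcases i with i | i <;> rcases j with j | j
      · rw [om_single_inl]
        simpa [linFrame] using (h i j).1
      · rw [om_single_inr]
        have := (h i j).2.2
        simp only [linFrame, Equiv.coe_fn_mk] at this
        rw [this, Pi.single_apply]
        simp [eq_comm]
      · rw [om_single_inl]
        have := (h j i).2.2
        simp only [linFrame, Equiv.coe_fn_mk] at this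
        rw [hskew, this, Pi.single_apply]
        simp only [Sum.inr.injEq]
        split_ifs <;> simp
      · rw [om_single_inr]
        simpa [linFrame] using (h i j).2.1
    intro v w
    have h2 := congrArg (fun B => B v w) this
    simpa using h2

theorem card_conf (p n : ℕ) [Fact p.Prime] (c : ZMod p) (hc : c ≠ 0) :
    Nat.card {L : (Fin n ⊕ Fin n → ZMod p) →ₗ[ZMod p] (Fin n ⊕ Fin n → ZMod p) //
      (∀ v w, om p n (L v) (L w) = c * om p n v w) ∧
       ∀ v, om p n (L v) 0 = c * om p n v 0} =
      p ^ (n ^ 2) * ∏ j ∈ Finset.Icc 1 n, (p ^ (2 * j) - 1) := by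
  rw [← card_frames c hc n (om p n) (om_self p n) (om_nd p n)
    (by simp [two_mul])]
  refine Nat.card_congr ((linFrame p n).subtypeEquiv fun L => ?_)
  rw [linFrame_iff]
  simp

theorem card_conf_fixed (p m : ℕ) [Fact p.Prime] (c : ZMod p) (hc : c ≠ 0) :
    Nat.card {L : (Fin (m + 1) ⊕ Fin (m + 1) → ZMod p) →ₗ[ZMod p]
        (Fin (m + 1) ⊕ Fin (m + 1) → ZMod p) //
      (∀ v w, om p (m + 1) (L v) (L w) = c * om p (m + 1) v w) ∧
       ∀ v, om p (m + 1) (L v) (Pi.single (Sum.inr 0) 1) =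
        c * om p (m + 1) v (Pi.single (Sum.inr 0) 1)} =
      p ^ (2 * m + 1) * (p ^ (m ^ 2) * ∏ j ∈ Finset.Icc 1 m, (p ^ (2 * j) - 1)) := by
  rw [← card_frames_fixed (om p (m + 1)) (om_self p _) (om_nd p _) c hc m _
    (by simp [two_mul]) (card_frames c hc m) (Pi.single (Sum.inr 0) 1) (by simp)]
  refine Nat.card_congr ((linFrame p (m + 1)).subtypeEquiv fun L => ?_)
  rw [← linFrame_iff]
  refine and_congr_right fun h => ?_
  have hLinj : Function.Injective L := by
    rw [← LinearMap.ker_eq_bot, LinearMap.ker_eq_bot']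
    intro v hv
    apply om_nd
    intro w
    have := h v w
    rw [hv] at this
    simpa [hc] using this
  have hLs : Function.Surjective L := LinearMap.injective_iff_surjective.1 hLinj
  have hskew : ∀ v w, om p (m + 1) v w = - om p (m + 1) w v := fun v w => by
    rw [om_eq, om_eq]; ring
  change _ ↔ L (Pi.single (Sum.inr 0) 1) = _
  constructor
  · intro h2
    rw [← sub_eq_zero]
    apply om_nd
    intro w
    obtain ⟨v, rfl⟩ := hLs w
    rw [hskew, map_sub, h, h2]
    simp
  · intro h2 v
    conv_lhs => rw [← h2]
    rw [h]

theorem card_pairs (p m : ℕ) [Fact p.Prime] (f : Fin (m + 1) ⊕ Fin (m + 1) → ZMod p) (N : ℕ)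
    (hN : ∀ c : ZMod p, c ≠ 0 →
      Nat.card {L : (Fin (m + 1) ⊕ Fin (m + 1) → ZMod p) →ₗ[ZMod p]
        (Fin (m + 1) ⊕ Fin (m + 1) → ZMod p) //
      (∀ v w, om p (m + 1) (L v) (L w) = c * om p (m + 1) v w) ∧
       ∀ v, om p (m + 1) (L v) f = c * om p (m + 1) v f} = N) :
    Nat.card {q : ((Fin (m + 1) ⊕ Fin (m + 1) → ZMod p) →ₗ[ZMod p]
        (Fin (m + 1) ⊕ Fin (m + 1) → ZMod p)) × ZMod p //
      (∀ v w, om p (m + 1) (q.1 v) (q.1 w) = q.2 * om p (m + 1) v w) ∧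
       ∀ v, om p (m + 1) (q.1 v) f = q.2 * om p (m + 1) v f} =
    (p - 1) * N + ∑ k ∈ Finset.range (m + 2),
            Nat.card {W : Submodule (ZMod p) (Fin (m + 1) ⊕ Fin (m + 1) → ZMod p) //
                ((∀ v ∈ W, ∀ w ∈ W, om p (m + 1) v w = 0) ∧
                (∀ v ∈ W, om p (m + 1) v f = 0)) ∧
                Module.finrank (ZMod p) W = k}
              * Nat.card {f : (Fin (m + 1) ⊕ Fin (m + 1) → ZMod p) →ₗ[ZMod p]
                    (Fin k → ZMod p) // Function.Surjective f} := by
  have : Finite ((Fin (m + 1) ⊕ Fin (m + 1) → ZMod p) →ₗ[ZMod p]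
        (Fin (m + 1) ⊕ Fin (m + 1) → ZMod p)) :=
    Finite.of_injective (fun L => (L : _ → _)) DFunLike.coe_injective
  let e : {q : ((Fin (m + 1) ⊕ Fin (m + 1) → ZMod p) →ₗ[ZMod p]
        (Fin (m + 1) ⊕ Fin (m + 1) → ZMod p)) × ZMod p //
      (∀ v w, om p (m + 1) (q.1 v) (q.1 w) = q.2 * om p (m + 1) v w) ∧
       ∀ v, om p (m + 1) (q.1 v) f = q.2 * om p (m + 1) v f} ≃
      Σ c : ZMod p, {L : (Fin (m + 1) ⊕ Fin (m + 1) → ZMod p) →ₗ[ZMod p]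
        (Fin (m + 1) ⊕ Fin (m + 1) → ZMod p) //
      (∀ v w, om p (m + 1) (L v) (L w) = c * om p (m + 1) v w) ∧
       ∀ v, om p (m + 1) (L v) f = c * om p (m + 1) v f} :=
    { toFun := fun q => ⟨q.1.2, q.1.1, q.2⟩
      invFun := fun q => ⟨(q.2.1, q.1), q.2.2⟩
      left_inv := fun q => rfl
      right_inv := fun q => rfl }
  rw [Nat.card_congr e, Nat.card_sigma, Fintype.sum_eq_add_sum_compl 0, add_comm]
  congr 1
  · rw [Finset.sum_congr rfl (fun c hc => hN c (by simpa using hc)), Finset.sum_const,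
      Finset.card_compl, ZMod.card]
    simp
  · rw [← card_isotropic_maps (fun W => (∀ v ∈ W, ∀ w ∈ W, om p (m + 1) v w = 0) ∧
                (∀ v ∈ W, om p (m + 1) v f = 0)) (m + 1)
      (fun W hW => isotropic_finrank_le (om p (m + 1)) (om_nd p _) (m + 1)
        (by simp [two_mul]) W hW.1)]
    refine Nat.card_congr (Equiv.subtypeEquivRight fun L => ?_)
    simp [LinearMap.mem_range]

/-- The non-symmetrised form. -/
def Bf (p n : ℕ) (v w : Fin n ⊕ Fin n → ZMod p) : ZMod p :=
  (fun i => v (Sum.inl i)) ⬝ᵥ (fun i => w (Sum.inr i))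

theorem Bf_add_left (p n : ℕ) (v v' w : Fin n ⊕ Fin n → ZMod p) :
    Bf p n (v + v') w = Bf p n v w + Bf p n v' w := by
  simp [Bf, dotProduct, add_mul, Finset.sum_add_distrib]

theorem Bf_add_right (p n : ℕ) (v w w' : Fin n ⊕ Fin n → ZMod p) :
    Bf p n v (w + w') = Bf p n v w + Bf p n v w' := by
  simp [Bf, dotProduct, mul_add, Finset.sum_add_distrib]

theorem om_Bf (p n : ℕ) (v w : Fin n ⊕ Fin n → ZMod p) :
    om p n v w = Bf p n v w - Bf p n w v := om_eq p n v w

theorem exists_quad (p n : ℕ) [Fact p.Prime] (hodd : Odd p) (c : ZMod p)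
    (L : (Fin n ⊕ Fin n → ZMod p) →ₗ[ZMod p] (Fin n ⊕ Fin n → ZMod p))
    (h : ∀ v w, om p n (L v) (L w) = c * om p n v w) :
    ∃ Q : (Fin n ⊕ Fin n → ZMod p) → ZMod p, Q 0 = 0 ∧ ∀ v w,
      Q (v + w) = Q v + Q w + Bf p n (L v) (L w) - c * Bf p n v w := by
  have h2 : (2 : ZMod p) ≠ 0 := by
    have : Fact (2 < p) := ⟨by
      have h2 := (Fact.out : p.Prime).two_le
      rcases hodd with ⟨k, hk⟩
      omega⟩
    have h3 : (-1 : ZMod p) ≠ 1 := ZMod.neg_one_ne_one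
    intro h4
    apply h3
    linear_combination -h4
  refine ⟨fun v => 2⁻¹ * (Bf p n (L v) (L v) - c * Bf p n v v), by simp [Bf], fun v w => ?_⟩
  have := h v w
  rw [om_Bf, om_Bf] at this
  simp only [map_add, Bf_add_left, Bf_add_right]
  field_simp
  linear_combination -this

theorem card_ES1 (p m : ℕ) [Fact p.Prime] (hodd : Odd p) :
    Nat.card (ES1 p (m + 1) →* ES1 p (m + 1)) =
    Nat.card {q : ((Fin (m + 1) ⊕ Fin (m + 1) → ZMod p) →ₗ[ZMod p]
        (Fin (m + 1) ⊕ Fin (m + 1) → ZMod p)) × ZMod p //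
      (∀ v w, om p (m + 1) (q.1 v) (q.1 w) = q.2 * om p (m + 1) v w) ∧
       ∀ v, om p (m + 1) (q.1 v) 0 = q.2 * om p (m + 1) v 0} *
    Nat.card ((Fin (m + 1) ⊕ Fin (m + 1) → ZMod p) →ₗ[ZMod p] ZMod p) := by
  refine abstract_count (om p (m + 1)) 0 (G := ES1 p (m + 1))
    (fun x => Sum.elim x.u x.w) (fun a => ⟨0, 0, a⟩) ?_ ?_ ?_ ?_ ?_ ?_ ?_ ?_ ?_ ?_
  · intro x y
    funext i
    rcases i with i | i <;> simp
  · intro v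
    refine ⟨⟨fun i => v (Sum.inl i), fun i => v (Sum.inr i), 0⟩, ?_⟩
    funext i
    rcases i with i | i <;> simp
  · intro a b
    ext <;> simp
  · intro a b h
    exact congrArg ES1.z h
  · intro a x
    ext <;> simp [add_comm]
  · intro x
    constructor
    · intro h
      refine ⟨x.z, ?_⟩
      ext i
      · exact congrFun h (Sum.inl i)
      · exact congrFun h (Sum.inr i)
      · rfl
    · rintro ⟨a, rfl⟩
      funext i
      rcases i with i | i <;> simp
  · intro x y
    ext
    · simp [add_comm]
    · simp [add_comm]
    · simp [om_eq]
      ring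
  · intro x
    have key : ∀ k : ℕ, x ^ k = ⟨k • x.u, k • x.w, k * x.z + (k.choose 2 : ℕ) * (x.u ⬝ᵥ x.w)⟩ := by
      intro k
      induction k with
      | zero => ext <;> simp
      | succ k ih =>
        rw [pow_succ, ih]
        ext
        · simp [add_mul]
        · simp [add_mul]
        · simp only [ES1.mul_z, smul_dotProduct, Nat.choose_succ_succ' k 1, Nat.choose_one_right]
          push_cast
          simp only [nsmul_eq_mul]
          ring
    rw [key]
    have hch : ((p.choose 2 : ℕ) : ZMod p) = 0 := by
      rw [ZMod.natCast_eq_zero_iff]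
      apply (Fact.out : p.Prime).dvd_choose_self (by norm_num)
      have h2 := (Fact.out : p.Prime).two_le
      rcases hodd with ⟨k, hk⟩
      omega
    ext
    · simp
    · simp
    · simp [hch]
  · exact ⟨Pi.single (Sum.inl 0) 1, Pi.single (Sum.inr 0) 1, by rw [om_single_inr]; simp⟩
  · intro L c h1 _
    obtain ⟨Q, hQ0, hQ⟩ := exists_quad p (m + 1) hodd c L h1
    have hπ : ∀ x y : ES1 p (m + 1), (Sum.elim (x * y).u (x * y).w : _ → ZMod p) =
        Sum.elim x.u x.w + Sum.elim y.u y.w := fun x y => by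
      funext i
      rcases i with i | i <;> simp
    refine ⟨MonoidHom.mk' (fun x => ⟨fun i => L (Sum.elim x.u x.w) (Sum.inl i),
      fun i => L (Sum.elim x.u x.w) (Sum.inr i), c * x.z + Q (Sum.elim x.u x.w)⟩) ?_, ?_, ?_⟩
    · intro x y
      ext
      · simp only [hπ]; simp
      · simp only [hπ]; simp
      · simp only [hπ, hQ, ES1.mul_z]
        have e1 : Bf p (m + 1) (Sum.elim x.u x.w) (Sum.elim y.u y.w) = x.u ⬝ᵥ y.w := rfl
        rw [e1]
        simp only [Bf]
        ring
    · intro x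
      funext i
      rcases i with i | i <;> simp
    · intro a
      have : (Sum.elim 0 0 : Fin (m + 1) ⊕ Fin (m + 1) → ZMod p) = 0 := by
        funext i
        rcases i with i | i <;> simp
      ext <;> simp [this, hQ0]

theorem emb_mul (p : ℕ) [NeZero p] (a : ZMod p) (t : ZMod (p ^ 2)) :
    emb p a * t = emb p (a * red p t) := by
  have : ∀ k : ℕ, emb p a * (k : ZMod (p ^ 2)) = emb p (a * k) := fun k => by
    induction k with
    | zero => simp [emb_zero]
    | succ k ih => push_cast; rw [mul_add, mul_add, ih, emb_add, mul_one, mul_one]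
  have h := this t.val
  have hN : NeZero (p ^ 2) := inferInstance
  rw [ZMod.natCast_zmod_val t] at h
  rw [h]
  congr 2
  rw [← map_natCast (red p), ZMod.natCast_zmod_val]

theorem emb_one (p : ℕ) [Fact p.Prime] : emb p 1 = (p : ZMod (p ^ 2)) := by
  have := Fact.mk (Fact.out : p.Prime).one_lt
  simp [emb, ZMod.val_one]

theorem emb_inj (p : ℕ) [Fact p.Prime] : Function.Injective (emb p) := by
  intro a b h
  rw [← sub_eq_zero, ← emb_sub] at h
  rw [← sub_eq_zero]
  generalize a - b = d at h
  unfold emb at h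
  rw [← Nat.cast_mul, ZMod.natCast_eq_zero_iff, pow_two] at h
  have h1 := Nat.dvd_of_mul_dvd_mul_left (Fact.out : p.Prime).pos h
  rw [← ZMod.natCast_zmod_val d, ZMod.natCast_eq_zero_iff]
  exact h1

theorem red_eq_zero (p : ℕ) [Fact p.Prime] (t : ZMod (p ^ 2)) (h : red p t = 0) :
    ∃ a, t = emb p a := by
  have h1 : ((t.val : ℕ) : ZMod p) = 0 := by
    rw [← map_natCast (red p), ZMod.natCast_zmod_val, h]
  rw [ZMod.natCast_eq_zero_iff] at h1
  obtain ⟨k, hk⟩ := h1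
  refine ⟨k, ?_⟩
  rw [← ZMod.natCast_zmod_val t, hk]
  push_cast
  rw [← emb_one, emb_mul, map_natCast, one_mul]

theorem red_surj (p : ℕ) [Fact p.Prime] (c : ZMod p) : ∃ t, red p t = c :=
  ⟨(c.val : ZMod (p ^ 2)), by rw [map_natCast, ZMod.natCast_zmod_val]⟩

/-- Projection of `ES2` to its Frattini quotient. -/
def pi2 {p m : ℕ} (x : ES2 p m) : Fin (m + 1) ⊕ Fin (m + 1) → ZMod p :=
  Sum.elim (Fin.cons (red p x.u1) x.u) (Fin.cons x.w1 x.w)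

theorem Bf_pi2 {p m : ℕ} (x y : ES2 p m) :
    Bf p (m + 1) (pi2 x) (pi2 y) = red p x.u1 * y.w1 + x.u ⬝ᵥ y.w := by
  simp [Bf, pi2, dotProduct, Fin.sum_univ_succ]

theorem pi2_mul {p m : ℕ} [NeZero p] (x y : ES2 p m) : pi2 (x * y) = pi2 x + pi2 y := by
  funext i
  rcases i with i | i <;> induction i using Fin.cases <;>
    simp [pi2, red_emb]

theorem ES2_mul_u1 {p m : ℕ} [NeZero p] (x y : ES2 p m) :
    (x * y).u1 = x.u1 + y.u1 + emb p (Bf p (m + 1) (pi2 x) (pi2 y)) := by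
  rw [ES2.mul_u1, Bf_pi2, emb_add, emb_mul, mul_comm y.w1]
  ring

theorem card_ES2 (p m : ℕ) [Fact p.Prime] (hodd : Odd p) :
    Nat.card (ES2 p m →* ES2 p m) =
    Nat.card {q : ((Fin (m + 1) ⊕ Fin (m + 1) → ZMod p) →ₗ[ZMod p]
        (Fin (m + 1) ⊕ Fin (m + 1) → ZMod p)) × ZMod p //
      (∀ v w, om p (m + 1) (q.1 v) (q.1 w) = q.2 * om p (m + 1) v w) ∧
       ∀ v, om p (m + 1) (q.1 v) (Pi.single (Sum.inr 0) 1) =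
        q.2 * om p (m + 1) v (Pi.single (Sum.inr 0) 1)} *
    Nat.card ((Fin (m + 1) ⊕ Fin (m + 1) → ZMod p) →ₗ[ZMod p] ZMod p) := by
  have hpi : ∀ a : ZMod p, pi2 (⟨emb p a, 0, 0, 0⟩ : ES2 p m) = 0 := fun a => by
    funext i
    rcases i with i | i <;> induction i using Fin.cases <;> simp [pi2, red_emb]
  refine abstract_count (om p (m + 1)) (Pi.single (Sum.inr 0) 1) (G := ES2 p m)
    pi2 (fun a => ⟨emb p a, 0, 0, 0⟩) pi2_mul ?_ ?_ ?_ ?_ ?_ ?_ ?_ ?_ ?_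
  · intro v
    obtain ⟨t, ht⟩ := red_surj p (v (Sum.inl 0))
    refine ⟨⟨t, fun i => v (Sum.inl i.succ), v (Sum.inr 0), fun i => v (Sum.inr i.succ)⟩, ?_⟩
    funext i
    rcases i with i | i <;> induction i using Fin.cases <;> simp [pi2, ht]
  · intro a b
    ext <;> simp [emb_zero, emb_add]
  · intro a b h
    exact emb_inj p (congrArg ES2.u1 h)
  · intro a x
    ext
    · rw [ES2_mul_u1, ES2_mul_u1, hpi]
      simp [Bf, add_comm]
    · simp
    · simp
    · simp
  · intro x
    constructor
    · intro h
      obtain ⟨a, ha⟩ := red_eq_zero p x.u1 (congrFun h (Sum.inl 0))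
      refine ⟨a, ?_⟩
      ext i
      · exact ha
      · simpa [pi2] using congrFun h (Sum.inl i.succ)
      · exact congrFun h (Sum.inr 0)
      · simpa [pi2] using congrFun h (Sum.inr i.succ)
    · rintro ⟨a, rfl⟩
      exact hpi a
  · intro x y
    ext
    · rw [ES2_mul_u1, ES2_mul_u1 (y * x), hpi, ES2_mul_u1, om_Bf, emb_sub]
      simp [Bf, emb_zero]
      ring
    · simp [add_comm]
    · simp [add_comm]
    · simp [add_comm]
  · intro x
    have key : ∀ k : ℕ, pi2 (x ^ k) = k • pi2 x ∧
        (x ^ k).u1 = k * x.u1 + emb p ((k.choose 2 : ℕ) * Bf p (m + 1) (pi2 x) (pi2 x)) ∧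
        (x ^ k).u = k • x.u ∧ (x ^ k).w1 = k • x.w1 ∧ (x ^ k).w = k • x.w := by
      intro k
      induction k with
      | zero =>
        have : (1 : ES2 p m) = ⟨emb p 0, 0, 0, 0⟩ := by ext <;> simp [emb_zero]
        refine ⟨?_, ?_, ?_, ?_, ?_⟩
        · rw [pow_zero, this, hpi]; simp
        all_goals simp [emb_zero]
      | succ k ih =>
        obtain ⟨h1, h2, h3, h4, h5⟩ := ih
        have hB : Bf p (m + 1) (k • pi2 x) (pi2 x) = k * Bf p (m + 1) (pi2 x) (pi2 x) := by
          simp [Bf, dotProduct, Finset.mul_sum, mul_assoc]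
        rw [pow_succ]
        refine ⟨?_, ?_, ?_, ?_, ?_⟩
        · rw [pi2_mul, h1, succ_nsmul]
        · rw [ES2_mul_u1, h1, h2, hB, Nat.choose_succ_succ' k 1, Nat.choose_one_right]
          push_cast
          rw [add_mul _ _ (Bf _ _ _ _), emb_add]
          ring
        · rw [ES2.mul_u, h3, succ_nsmul]
        · rw [ES2.mul_w1, h4, succ_nsmul]
        · rw [ES2.mul_w, h5, succ_nsmul]
    have hch : ((p.choose 2 : ℕ) : ZMod p) = 0 := by
      rw [ZMod.natCast_eq_zero_iff]
      apply (Fact.out : p.Prime).dvd_choose_self (by norm_num)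
      have h2 := (Fact.out : p.Prime).two_le
      rcases hodd with ⟨k, hk⟩
      omega
    obtain ⟨-, h2, h3, h4, h5⟩ := key p
    ext
    · rw [h2, hch, zero_mul, emb_zero, add_zero, om_single_inr, ← emb_one, emb_mul, one_mul]
      rfl
    · rw [h3]; simp
    · rw [h4]; simp
    · rw [h5]; simp
  · exact ⟨Pi.single (Sum.inl 0) 1, Pi.single (Sum.inr 0) 1, by rw [om_single_inr]; simp⟩
  · intro L c h1 h2
    obtain ⟨Q, hQ0, hQ⟩ := exists_quad p (m + 1) hodd c L h1
    obtain ⟨t, ht⟩ := red_surj p c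
    simp only [om_single_inr] at h2
    let g : ES2 p m → ES2 p m := fun x => ⟨t * x.u1 + emb p (Q (pi2 x)),
      fun i => L (pi2 x) (Sum.inl i.succ), L (pi2 x) (Sum.inr 0),
      fun i => L (pi2 x) (Sum.inr i.succ)⟩
    have hg : ∀ x, pi2 (g x) = L (pi2 x) := fun x => by
      funext i
      rcases i with i | i
      · induction i using Fin.cases with
        | zero =>
          rw [h2]
          simp [pi2, g, red_emb, ht]
        | succ i => simp [pi2, g]
      · induction i using Fin.cases with
        | zero => simp [pi2, g]
        | succ i => simp [pi2, g]
    refine ⟨MonoidHom.mk' g ?_, hg, ?_⟩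
    · intro x y
      ext
      · rw [ES2_mul_u1, hg, hg]
        simp only [g, ES2_mul_u1, pi2_mul, hQ, emb_add, emb_sub, mul_add]
        rw [mul_comm t (emb p _), emb_mul, ht, mul_comm c]
        ring
      · simp [g, pi2_mul]
      · simp [g, pi2_mul]
      · simp [g, pi2_mul]
    · intro a
      ext
      · simp [g, hpi, hQ0, emb_zero]
        rw [mul_comm t, emb_mul, ht, mul_comm]
      · simp [g, hpi]
      · simp [g, hpi]
      · simp [g, hpi]

theorem card_dual (p m : ℕ) [Fact p.Prime] :
    Nat.card ((Fin (m + 1) ⊕ Fin (m + 1) → ZMod p) →ₗ[ZMod p] ZMod p) = p ^ (2 * (m + 1)) := by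
  rw [Module.natCard_eq_pow_finrank (K := ZMod p), Nat.card_zmod]
  congr 1
  have := Subspace.dual_finrank_eq (K := ZMod p) (V := Fin (m + 1) ⊕ Fin (m + 1) → ZMod p)
  exact this.trans (by simp [two_mul])


theorem card_end_extraspecial (p m : ℕ) [Fact p.Prime] (hodd : Odd p) :
    Nat.card (ES1 p (m + 1) →* ES1 p (m + 1))
      = p ^ ((m + 1) ^ 2 + 2 * (m + 1)) * (p - 1)
          * ∏ j ∈ Finset.Icc 1 (m + 1), (p ^ (2 * j) - 1)
        + p ^ (2 * (m + 1)) * ∑ k ∈ Finset.range (m + 2),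
            Nat.card {W : Submodule (ZMod p) (Fin (m + 1) ⊕ Fin (m + 1) → ZMod p) //
                (∀ v ∈ W, ∀ w ∈ W, v ⬝ᵥ (Delta p (m + 1) *ᵥ w) = 0) ∧
                Module.finrank (ZMod p) W = k}
              * Nat.card {f : (Fin (m + 1) ⊕ Fin (m + 1) → ZMod p) →ₗ[ZMod p]
                    (Fin k → ZMod p) // Function.Surjective f} ∧
    Nat.card (ES2 p m →* ES2 p m)
      = p ^ ((m + 1) ^ 2 + 2 * (m + 1)) * (p - 1)
          * ∏ j ∈ Finset.Icc 1 m, (p ^ (2 * j) - 1)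
        + p ^ (2 * (m + 1)) * ∑ k ∈ Finset.range (m + 2),
            Nat.card {W : Submodule (ZMod p) (Fin (m + 1) ⊕ Fin (m + 1) → ZMod p) //
                (∀ v ∈ W, ∀ w ∈ W, v ⬝ᵥ (Delta p (m + 1) *ᵥ w) = 0) ∧
                (∀ v ∈ W, v (Sum.inl 0) = 0) ∧
                Module.finrank (ZMod p) W = k}
              * Nat.card {f : (Fin (m + 1) ⊕ Fin (m + 1) → ZMod p) →ₗ[ZMod p]
                    (Fin k → ZMod p) // Function.Surjective f} := by
  refine ⟨?_, ?_⟩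
  · rw [card_ES1 p m hodd, card_dual, card_pairs p m 0 _ (fun c hc => card_conf p (m + 1) c hc)]
    simp only [om_apply, Matrix.mulVec_zero, dotProduct_zero, implies_true, and_true]
    ring
  · rw [card_ES2 p m hodd, card_dual, card_pairs p m (Pi.single (Sum.inr 0) 1) _
      (fun c hc => card_conf_fixed p m c hc)]
    simp only [om_single_inr]
    simp only [om_apply, and_assoc]
    ring
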